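/- arXiv:2605.10802 — 2 statements merged into one kernel-verified Lean document; each statement's English description precedes it below -/
import Mathlib

section
/- In the gadget setting, let 0 ≤ ε < 1/11 and let (p, x) be an ε-approximate market equilibrium. Let i be a NAND-inverter with input goods in1, in2 and output good out, and suppose 0 < p_in1 ≤ H, 0 < p_in2 ≤ H, p_out > 0, and x_{i,out} > 0. Then t − 5/k ≤ x_{i,in1} ≤ t and t − 5/k ≤ x_{i,in2} ≤ t. -/
open Finset

/-- A Fisher market: finitely many divisible goods `G` (one unit of each),
finitely many buyers `B`, positive budgets, and SPLC utilities.  Each per-good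
utility `util i j` is, on `[0, ∞)`, a minimum of finitely many affine functions
(equivalently: continuous, piecewise-linear with finitely many pieces, and
concave), is non-decreasing on `[0, ∞)`, and vanishes at `0`. -/
structure FisherMarket (G B : Type) [Fintype G] [Fintype B] where
  budget : B → ℝ
  budget_pos : ∀ i, 0 < budget i
  util : B → G → ℝ → ℝ
  util_zero : ∀ i j, util i j 0 = 0
  util_mono : ∀ i j, MonotoneOn (util i j) (Set.Ici 0)
  util_pl : ∀ i j, ∃ S : Finset (ℝ × ℝ), ∃ hS : S.Nonempty,
      ∀ y ∈ Set.Ici (0 : ℝ), util i j y = S.inf' hS fun mb => mb.1 * y + mb.2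

namespace FisherMarket

variable {G B : Type} [Fintype G] [Fintype B]

/-- Total SPLC utility of buyer `i` at bundle `x`. -/
def totalUtil (M : FisherMarket G B) (i : B) (x : G → ℝ) : ℝ :=
  ∑ j, M.util i j (x j)

/-- `x` is a feasible bundle for buyer `i` at prices `p`. -/
def Feasible (M : FisherMarket G B) (p : G → ℝ) (i : B) (x : G → ℝ) : Prop :=
  (∀ j, 0 ≤ x j) ∧ ∑ j, p j * x j ≤ M.budget i

/-- `x` is an optimal bundle for buyer `i` at prices `p`, i.e. `x ∈ opt_i(p)`. -/
def IsOptimal (M : FisherMarket G B) (p : G → ℝ) (i : B) (x : G → ℝ) : Prop :=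
  M.Feasible p i x ∧ ∀ y, M.Feasible p i y → M.totalUtil i y ≤ M.totalUtil i x

/-- `(p, x)` is an `ε`-approximate market equilibrium of the Fisher market. -/
def IsApproxEquilibrium (M : FisherMarket G B) (ε : ℝ) (p : G → ℝ)
    (x : B → G → ℝ) : Prop :=
  (∀ j, 0 ≤ p j) ∧ (∀ i, M.IsOptimal p i (x i)) ∧ ∀ j, |(∑ i, x i j) - 1| ≤ ε

end FisherMarket

variable {G B : Type} [Fintype G] [Fintype B]

/-- Buyer `i` is a NOT-inverter with input good `gin` and output good `gout`:
its budget is `t * Hlow` and its utility is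
`a * min x_gin t + s * x_gout + x_ref` (zero for all other goods). -/
def IsNotInverter (M : FisherMarket G B) (s a t Hlow : ℝ) (ref gin gout : G)
    (i : B) : Prop :=
  gin ≠ gout ∧ gin ≠ ref ∧ gout ≠ ref ∧
  M.budget i = t * Hlow ∧
  (∀ y ∈ Set.Ici (0 : ℝ), M.util i gin y = a * min y t) ∧
  (∀ y ∈ Set.Ici (0 : ℝ), M.util i gout y = s * y) ∧
  (∀ y ∈ Set.Ici (0 : ℝ), M.util i ref y = y) ∧
  ∀ j, j ≠ gin → j ≠ gout → j ≠ ref → ∀ y ∈ Set.Ici (0 : ℝ), M.util i j y = 0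

/-- Buyer `i` is a NAND-inverter with input goods `gin1, gin2` and output good
`gout`: its budget is `2 * t * Hlow` and its utility is
`a * min x_gin1 t + a * min x_gin2 t + s * x_gout + x_ref`
(zero for all other goods). -/
def IsNandInverter (M : FisherMarket G B) (s a t Hlow : ℝ)
    (ref gin1 gin2 gout : G) (i : B) : Prop :=
  gin1 ≠ gin2 ∧ gin1 ≠ gout ∧ gin2 ≠ gout ∧
  gin1 ≠ ref ∧ gin2 ≠ ref ∧ gout ≠ ref ∧
  M.budget i = 2 * t * Hlow ∧
  (∀ y ∈ Set.Ici (0 : ℝ), M.util i gin1 y = a * min y t) ∧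
  (∀ y ∈ Set.Ici (0 : ℝ), M.util i gin2 y = a * min y t) ∧
  (∀ y ∈ Set.Ici (0 : ℝ), M.util i gout y = s * y) ∧
  (∀ y ∈ Set.Ici (0 : ℝ), M.util i ref y = y) ∧
  ∀ j, j ≠ gin1 → j ≠ gin2 → j ≠ gout → j ≠ ref →
    ∀ y ∈ Set.Ici (0 : ℝ), M.util i j y = 0

/-- Buyer `i` is the auxiliary buyer `aux(j, r)`: its budget is `r * Hhigh`
and its utility is `2 * s * min x_j r + x_ref` (zero for all other goods). -/
def IsAuxBuyer (M : FisherMarket G B) (s Hhigh : ℝ) (ref j : G) (r : ℝ)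
    (i : B) : Prop :=
  j ≠ ref ∧ 0 ≤ r ∧ r ≤ 1 ∧
  M.budget i = r * Hhigh ∧
  (∀ y ∈ Set.Ici (0 : ℝ), M.util i j y = 2 * s * min y r) ∧
  (∀ y ∈ Set.Ici (0 : ℝ), M.util i ref y = y) ∧
  ∀ j', j' ≠ j → j' ≠ ref → ∀ y ∈ Set.Ici (0 : ℝ), M.util i j' y = 0

namespace FisherMarket

theorem IsOptimal.util_add_util_le {M : FisherMarket G B} {p : G → ℝ} {i : B} {x : G → ℝ}
    (h : M.IsOptimal p i x) {j l : G} (hjl : j ≠ l) {v w : ℝ} (hv : 0 ≤ v) (hw : 0 ≤ w)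
    (hcost : ∑ m, p m * x m + p j * (v - x j) + p l * (w - x l) ≤ M.budget i) :
    M.util i j v + M.util i l w ≤ M.util i j (x j) + M.util i l (x l) := by
  classical
  set y : G → ℝ := fun m => if m = j then v else if m = l then w else x m with hy
  have hyj : y j = v := by simp [hy]
  have hyl : y l = w := by simp [hy, hjl.symm]
  have hym : ∀ m, m ≠ j ∧ m ≠ l → y m = x m := fun m hm => by simp [hy, hm.1, hm.2]
  have sum_exchange : ∀ f : G → ℝ → ℝ,
      ∑ m, f m (y m) = ∑ m, f m (x m) + (f j v - f j (x j)) + (f l w - f l (x l)) := by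
    intro f
    have hsub : ∑ m, (f m (y m) - f m (x m)) =
        (f j (y j) - f j (x j)) + (f l (y l) - f l (x l)) :=
      Fintype.sum_eq_add j l hjl fun m hm => by rw [hym m hm, sub_self]
    rw [sum_sub_distrib, hyj, hyl] at hsub
    linarith
  have hfeas : M.Feasible p i y := by
    refine ⟨fun m => ?_, ?_⟩
    · by_cases hmj : m = j
      · rwa [hmj, hyj]
      by_cases hml : m = l
      · rwa [hml, hyl]
      rw [hym m ⟨hmj, hml⟩]
      exact h.1.1 m
    · have := sum_exchange fun m z => p m * z
      linarith
  have hle := h.2 y hfeas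
  have := sum_exchange (M.util i)
  unfold totalUtil at hle
  linarith

section LinearGood

variable {M : FisherMarket G B} {p : G → ℝ} {i : B} {x : G → ℝ} {g : G} {s : ℝ}

/-- Moving money between a good `l` and a good `g` of linear utility `s` does not help. -/
theorem IsOptimal.mul_le_of_linear (h : M.IsOptimal p i x)
    (hlin : ∀ y ∈ Set.Ici (0 : ℝ), M.util i g y = s * y) (hpg : 0 < p g)
    {l : G} (hl : l ≠ g) {w : ℝ} (hw : 0 ≤ w) (hmoney : 0 ≤ p g * x g + p l * (x l - w)) :
    s * (p l * (x l - w)) ≤ p g * (M.util i l (x l) - M.util i l w) := by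
  have hv : 0 ≤ x g + p l * (x l - w) / p g := by
    rw [show x g + p l * (x l - w) / p g = (p g * x g + p l * (x l - w)) / p g by field_simp]
    positivity
  have hcancel : p g * (p l * (x l - w) / p g) = p l * (x l - w) := by field_simp
  have hle := h.util_add_util_le hl.symm hv hw (by
    have := h.1.2
    rw [add_sub_cancel_left, hcancel]
    linarith)
  rw [hlin _ hv, hlin _ (h.1.1 g)] at hle
  rw [← hcancel]
  nlinarith [mul_le_mul_of_nonneg_left hle hpg.le]

/-- A buyer with a good of linear positive utility other than `l` exhausts the budget. -/
theorem IsOptimal.cost_eq_budget (h : M.IsOptimal p i x) (hs : 0 < s)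
    (hlin : ∀ y ∈ Set.Ici (0 : ℝ), M.util i g y = s * y) (hpg : 0 < p g)
    {l : G} (hl : l ≠ g) : ∑ m, p m * x m = M.budget i := by
  refine le_antisymm h.1.2 (not_lt.1 fun hlt => ?_)
  set r := (M.budget i - ∑ m, p m * x m) / p g with hr
  have hr0 : 0 < r := div_pos (sub_pos.2 hlt) hpg
  have hcancel : p g * r = M.budget i - ∑ m, p m * x m := by
    rw [hr]; field_simp
  have hv : 0 ≤ x g + r := add_nonneg (h.1.1 g) hr0.le
  have hle := h.util_add_util_le hl.symm hv (h.1.1 l) (by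
    rw [add_sub_cancel_left, hcancel]
    linarith)
  rw [hlin _ hv, hlin _ (h.1.1 g)] at hle
  nlinarith [mul_pos hs hr0]

variable {a t : ℝ} {gin : G}

theorem IsOptimal.le_of_capped (h : M.IsOptimal p i x) (hs : 0 < s)
    (hlin : ∀ y ∈ Set.Ici (0 : ℝ), M.util i g y = s * y) (hpg : 0 < p g)
    (hne : gin ≠ g) (hpin : 0 < p gin) (ht : 0 ≤ t)
    (hcap : ∀ y ∈ Set.Ici (0 : ℝ), M.util i gin y = a * min y t) : x gin ≤ t := by
  by_contra! hlt
  have hgain : 0 < p gin * (x gin - t) := mul_pos hpin (sub_pos.2 hlt)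
  have hle := h.mul_le_of_linear hlin hpg hne ht
    (add_nonneg (mul_nonneg hpg.le (h.1.1 g)) hgain.le)
  rw [hcap _ (h.1.1 gin), hcap _ ht, min_eq_right hlt.le, min_self, sub_self, mul_zero] at hle
  nlinarith [mul_pos hs hgain]

theorem IsOptimal.price_mul_le_of_lt_cap (h : M.IsOptimal p i x)
    (hlin : ∀ y ∈ Set.Ici (0 : ℝ), M.util i g y = s * y) (hpg : 0 < p g) (hxg : 0 < x g)
    (hne : gin ≠ g) (hpin : 0 < p gin)
    (hcap : ∀ y ∈ Set.Ici (0 : ℝ), M.util i gin y = a * min y t) (hlt : x gin < t) :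
    a * p g ≤ s * p gin := by
  set d := min (t - x gin) (p g * x g / p gin) with hd
  have hd0 : 0 < d := lt_min (sub_pos.2 hlt) (by positivity)
  have hdt : x gin + d ≤ t := by linarith [min_le_left (t - x gin) (p g * x g / p gin)]
  have hdg : d * p gin ≤ p g * x g := (le_div_iff₀ hpin).1 (min_le_right _ _)
  have hw : 0 ≤ x gin + d := add_nonneg (h.1.1 gin) hd0.le
  have hle := h.mul_le_of_linear hlin hpg hne hw (by linarith)
  rw [hcap _ (h.1.1 gin), hcap _ hw, min_eq_left hlt.le, min_eq_left hdt] at hle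
  exact le_of_mul_le_mul_right (by linarith) hd0

end LinearGood

theorem IsApproxEquilibrium.le_one_add {M : FisherMarket G B} {ε : ℝ} {p : G → ℝ}
    {x : B → G → ℝ} (h : M.IsApproxEquilibrium ε p x) (i : B) (j : G) : x i j ≤ 1 + ε := by
  have hsingle : x i j ≤ ∑ b, x b j :=
    single_le_sum (f := fun b => x b j) (fun b _ => (h.2.1 b).1.1 j) (mem_univ i)
  linarith [(abs_le.1 (h.2.2 j)).2]

end FisherMarket

section NandInverter

variable {M : FisherMarket G B} {s a t Hlow : ℝ} {ref gin1 gin2 gout : G} {i : B}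

theorem IsNandInverter.swap (h : IsNandInverter M s a t Hlow ref gin1 gin2 gout i) :
    IsNandInverter M s a t Hlow ref gin2 gin1 gout i := by
  obtain ⟨h12, h1o, h2o, h1r, h2r, hor, hb, hu1, hu2, huo, hur, hu⟩ := h
  exact ⟨h12.symm, h2o, h1o, h2r, h1r, hor, hb, hu2, hu1, huo, hur,
    fun j hj2 hj1 => hu j hj1 hj2⟩

/-- If the first input is not bought up to its cap, the budget is spent on the inputs and the output
only, and the output good is cheap. -/
theorem IsNandInverter.budget_le_of_lt_cap
    (hinv : IsNandInverter M s a t Hlow ref gin1 gin2 gout i) {p y : G → ℝ} {H : ℝ}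
    (hopt : M.IsOptimal p i y) (hs : 0 < s) (hsa : s < a) (hH : 0 < H) (href : p ref = H / s)
    (hpin1 : 0 < p gin1) (hpin1H : p gin1 ≤ H) (hpout : 0 < p gout) (hyout : 0 < y gout)
    (hlt : y gin1 < t) :
    a * p gout ≤ s * H ∧
      2 * t * Hlow ≤ p gin1 * y gin1 + p gin2 * y gin2 + p gout * y gout := by
  classical
  obtain ⟨h12, h1o, h2o, h1r, h2r, hor, hb, hu1, hu2, huo, hur, hu⟩ := hinv
  have hcheap : a * p gout ≤ s * H :=
    (hopt.price_mul_le_of_lt_cap huo hpout hyout h1o hpin1 hu1 hlt).trans (by gcongr)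
  have hoH : p gout < H := by
    by_contra! hle
    nlinarith [mul_lt_mul_of_pos_right hsa hH, mul_le_mul_of_nonneg_left hle (hs.trans hsa).le]
  have hyref : y ref = 0 := by
    refine le_antisymm (not_lt.1 fun hpos => ?_) (hopt.1.1 ref)
    have hle := hopt.mul_le_of_linear huo hpout hor.symm le_rfl (by
      rw [href, sub_zero]
      positivity)
    rw [hur _ (hopt.1.1 ref), hur _ (Set.mem_Ici.2 le_rfl), href, sub_zero,
      show s * (H / s * y ref) = H * y ref by field_simp] at hle
    nlinarith [mul_lt_mul_of_pos_right hoH hpos]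
  have hother : ∀ j, j ∉ ({gin1, gin2, gout} : Finset G) → p j * y j ≤ 0 := by
    intro j hj
    simp only [mem_insert, mem_singleton, not_or] at hj
    obtain ⟨hj1, hj2, hjo⟩ := hj
    by_cases hjr : j = ref
    · rw [hjr, hyref, mul_zero]
    by_contra! hpos
    have hle := hopt.mul_le_of_linear huo hpout hjo le_rfl (by
      rw [sub_zero]
      positivity)
    rw [hu j hj1 hj2 hjo hjr _ (hopt.1.1 j), hu j hj1 hj2 hjo hjr _ (Set.mem_Ici.2 le_rfl),
      sub_zero, sub_zero, mul_zero] at hle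
    nlinarith [mul_pos hs hpos]
  have hspent := hopt.cost_eq_budget hs huo hpout h1o
  rw [hb, ← sum_add_sum_compl {gin1, gin2, gout}, sum_insert (by simp [h12, h1o]),
    sum_pair h2o] at hspent
  have := sum_nonpos fun j hj => hother j (mem_compl.1 hj)
  exact ⟨hcheap, by linarith⟩

theorem IsNandInverter.input_bounds
    (hinv : IsNandInverter M s a t Hlow ref gin1 gin2 gout i) {ε : ℝ} (hε : ε < 1 / 11)
    {p : G → ℝ} {x : B → G → ℝ} (heq : M.IsApproxEquilibrium ε p x) {k H Hhigh : ℝ}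
    (hs : 0 < s) (hsa : s < a) (ha : 1 ≤ a) (ht0 : 0 < t) (ht2 : t ≤ 1 / 2)
    (hk : 0 < k) (hsk : s ≤ 1 / (20 * k)) (hH0 : 0 < H) (hHhigh : H ≤ Hhigh)
    (hratio : 1 - 4 / k ≤ Hlow / Hhigh) (hratio0 : 0 ≤ Hlow / Hhigh)
    (href : p ref = H / s)
    (hpin1 : 0 < p gin1) (hpin1H : p gin1 ≤ H) (hpin2 : 0 < p gin2) (hpin2H : p gin2 ≤ H)
    (hpout : 0 < p gout) (hxout : 0 < x i gout) :
    t - 5 / k ≤ x i gin1 ∧ x i gin1 ≤ t := by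
  have hopt := heq.2.1 i
  have ⟨_, h1o, h2o, _, _, _, _, hu1, hu2, huo, _⟩ := hinv
  have hx1 : x i gin1 ≤ t := hopt.le_of_capped hs huo hpout h1o hpin1 ht0.le hu1
  have hx2 : x i gin2 ≤ t := hopt.le_of_capped hs huo hpout h2o hpin2 ht0.le hu2
  refine ⟨?_, hx1⟩
  by_contra! hlow
  have hk0 : 0 < 1 / k := by positivity
  have h5k : 5 / k = 5 * (1 / k) := by ring
  have h4k : 4 / k = 4 * (1 / k) := by ring
  have hsk' : s ≤ 1 / 20 * (1 / k) := hsk.trans_eq (by ring)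
  obtain ⟨hcheap, hspent⟩ := hinv.budget_le_of_lt_cap hopt hs hsa hH0 href hpin1 hpin1H hpout
    hxout (by linarith)
  have hpo : p gout ≤ s * H := by nlinarith
  have h1 : p gin1 * x i gin1 ≤ H * x i gin1 := mul_le_mul_of_nonneg_right hpin1H (hopt.1.1 _)
  have h2 : p gin2 * x i gin2 ≤ H * t :=
    mul_le_mul hpin2H hx2 (hopt.1.1 _) hH0.le
  have h3 : p gout * x i gout ≤ s * H * (12 / 11) :=
    mul_le_mul hpo (by linarith [heq.le_one_add i gout]) hxout.le (by positivity)
  have hlowH : (1 - 4 / k) * H ≤ Hlow := by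
    have hhigh : 0 < Hhigh := hH0.trans_le hHhigh
    calc (1 - 4 / k) * H ≤ Hlow / Hhigh * H := by gcongr
      _ ≤ Hlow / Hhigh * Hhigh := by gcongr
      _ = Hlow := by field_simp
  have h4 : 2 * t * ((1 - 4 / k) * H) ≤ 2 * t * Hlow := by gcongr
  have h5 : H * (2 * t * (1 - 4 / k)) ≤ H * (x i gin1 + t + s * (12 / 11)) := by linarith
  have h6 := le_of_mul_le_mul_left h5 hH0
  rw [h4k] at h6
  nlinarith [mul_le_mul_of_nonneg_right ht2 hk0.le]

end NandInverter

/-- at an ε-approximate equilibrium (0 ≤ ε < 1/11), a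
NAND-inverter with `0 < p_in1 ≤ H`, `0 < p_in2 ≤ H`, `p_out > 0`, buying a
positive amount of its output good, buys between `t - 5/k` and `t` units of
each of its input goods. -/
theorem stmt_8 {G B : Type} [Fintype G] [Fintype B]
    (M : FisherMarket G B) (ε : ℝ) (hε0 : 0 ≤ ε) (hε1 : ε < 1 / 11)
    (p : G → ℝ) (x : B → G → ℝ) (heq : M.IsApproxEquilibrium ε p x)
    (s a t k H Hlow Hhigh : ℝ)
    (hs : 0 < s) (hsa : s < a) (ha : 1 ≤ a)
    (ht0 : 0 < t) (ht2 : t ≤ 1 / 2)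
    (hk : 110 < k) (hsk : s ≤ 1 / (20 * k))
    (hHlow0 : 0 < Hlow) (hHlowH : Hlow ≤ H) (hHhigh : H ≤ Hhigh)
    (hratio : 1 - 4 / k ≤ Hlow / Hhigh)
    (ref : G) (href : p ref = H / s)
    (gin1 gin2 gout : G) (i : B)
    (hinv : IsNandInverter M s a t Hlow ref gin1 gin2 gout i)
    (hpin1 : 0 < p gin1) (hpin1H : p gin1 ≤ H)
    (hpin2 : 0 < p gin2) (hpin2H : p gin2 ≤ H)
    (hpout : 0 < p gout) (hxout : 0 < x i gout) :
    (t - 5 / k ≤ x i gin1 ∧ x i gin1 ≤ t) ∧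
    (t - 5 / k ≤ x i gin2 ∧ x i gin2 ≤ t) := by
  have hratio0 : 0 ≤ Hlow / Hhigh := by
    have : 0 < Hhigh := by linarith
    positivity
  have hH0 : 0 < H := hHlow0.trans_le hHlowH
  have hk0 : 0 < k := by linarith
  exact ⟨hinv.input_bounds hε1 heq hs hsa ha ht0 ht2 hk0 hsk hH0 hHhigh hratio hratio0 href
      hpin1 hpin1H hpin2 hpin2H hpout hxout,
    hinv.swap.input_bounds hε1 heq hs hsa ha ht0 ht2 hk0 hsk hH0 hHhigh hratio hratio0 href
      hpin2 hpin2H hpin1 hpin1H hpout hxout⟩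
end

section
/- In the gadget setting, let ε ≥ 0 and r ∈ [0, 1] satisfy 1 − 2t − r − ε > 0, and let (p, x) be an ε-approximate market equilibrium. Let i be a NOT-inverter with input good in and output good out, suppose p_in > 0 and p_out > 0, and suppose the total amount of good out allocated to buyers other than i satisfies Σ_{i'≠i} x_{i',out} ≥ 2t̄ + r, where t̄ = t − 5/k. Then p_out ≥ min( H, (H_low − p_in)·t/(1 − 2t̄ − r + ε) ). -/
open Finset

variable {G B : Type} [Fintype G] [Fintype B]

/-- A sum supported on three distinct points. -/
theorem sum_eq_three {ι : Type*} [Fintype ι] {f : ι → ℝ} {b c d : ι}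
    (hbc : b ≠ c) (hbd : b ≠ d) (hcd : c ≠ d)
    (h : ∀ j, j ≠ b → j ≠ c → j ≠ d → f j = 0) : ∑ j, f j = f b + f c + f d := by
  classical
  rw [← Finset.sum_subset (Finset.subset_univ {b, c, d})
    (fun j _ hj => by simp only [Finset.mem_insert, Finset.mem_singleton, not_or] at hj
                      exact h j hj.1 hj.2.1 hj.2.2)]
  rw [Finset.sum_insert (by simp [hbc, hbd]), Finset.sum_pair hcd, add_assoc]

/-- A sum of non-negative terms dominates any three of them. -/
theorem three_le_sum {ι : Type*} [Fintype ι] {f : ι → ℝ} {b c d : ι}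
    (hbc : b ≠ c) (hbd : b ≠ d) (hcd : c ≠ d)
    (h : ∀ j, 0 ≤ f j) : f b + f c + f d ≤ ∑ j, f j := by
  classical
  refine le_trans (le_of_eq ?_)
    (Finset.sum_le_sum_of_subset_of_nonneg (Finset.subset_univ {b, c, d}) fun j _ _ => h j)
  rw [Finset.sum_insert (by simp [hbc, hbd]), Finset.sum_pair hcd, add_assoc]

namespace IsNotInverter

variable {M : FisherMarket G B} {s a t Hlow : ℝ} {ref gin gout : G} {i : B}

theorem totalUtil_eq (h : IsNotInverter M s a t Hlow ref gin gout i) {z : G → ℝ}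
    (hz : ∀ j, 0 ≤ z j) :
    M.totalUtil i z = a * min (z gin) t + s * z gout + z ref := by
  obtain ⟨hio, hir, hor, -, hin, hout, hr, h0⟩ := h
  unfold FisherMarket.totalUtil
  rw [sum_eq_three hio hir hor fun j h1 h2 h3 => h0 j h1 h2 h3 _ (hz j),
    hin _ (hz _), hout _ (hz _), hr _ (hz _)]

/-- An optimal bundle of a NOT-inverter does at least as well as truncating the input
at `t` and spending the rest of the budget on the output good. -/
theorem budget_le (h : IsNotInverter M s a t Hlow ref gin gout i) (hs : 0 < s) (ht : 0 < t)
    {p z : G → ℝ} (hp : ∀ j, 0 ≤ p j) (hpout : 0 < p gout) (hz : M.IsOptimal p i z) :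
    t * Hlow ≤ p gin * min (z gin) t + p gout * z gout + p gout / s * z ref := by
  classical
  obtain ⟨⟨hz0, hzb⟩, hopt⟩ := hz
  have hu := fun {w : G → ℝ} (hw : ∀ j, 0 ≤ w j) => h.totalUtil_eq hw
  obtain ⟨hio, hir, hor, hb, -⟩ := h
  rw [hb] at hzb
  set m := min (z gin) t
  have hm0 : 0 ≤ m := le_min (hz0 _) ht.le
  have hspend : p gin * m ≤ t * Hlow :=
    calc p gin * m ≤ p gin * z gin := mul_le_mul_of_nonneg_left (min_le_left _ _) (hp _)
      _ ≤ ∑ j, p j * z j := Finset.single_le_sum (f := fun j => p j * z j)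
          (fun j _ => mul_nonneg (hp j) (hz0 j)) (Finset.mem_univ gin)
      _ ≤ t * Hlow := hzb
  set q := (t * Hlow - p gin * m) / p gout with hq
  have hq0 : 0 ≤ q := div_nonneg (sub_nonneg.2 hspend) hpout.le
  have hpq : p gout * q = t * Hlow - p gin * m := mul_div_cancel₀ _ hpout.ne'
  let y : G → ℝ := fun j => if j = gin then m else if j = gout then q else 0
  have hyin : y gin = m := by simp [y]
  have hyout : y gout = q := by simp [y, hio.symm]
  have hyref : y ref = 0 := by simp [y, hir.symm, hor.symm]
  have hy0 : ∀ j, 0 ≤ y j := fun j => by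
    dsimp only [y]
    split_ifs <;> first | assumption | exact le_rfl
  have hyb : ∑ j, p j * y j ≤ M.budget i := by
    rw [sum_eq_three hio hir hor fun j h1 h2 _ => by simp [y, h1, h2], hyin, hyout, hyref, hpq, hb]
    linarith
  have hle := hopt y ⟨hy0, hyb⟩
  rw [hu hy0, hu hz0, hyin, hyout, hyref, min_eq_left (min_le_right _ _ : m ≤ t)] at hle
  have hq_le : q ≤ z gout + z ref / s := by
    rw [← sub_le_iff_le_add', le_div_iff₀ hs]
    linarith
  have hmul := mul_le_mul_of_nonneg_left hq_le hpout.le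
  rw [hpq] at hmul
  have : p gout * (z gout + z ref / s) = p gout * z gout + p gout / s * z ref := by ring
  linarith

end IsNotInverter

/-- lower bound on the output price of a NOT gadget at an
ε-approximate equilibrium, when buyers other than the inverter get at least
`2t̄ + r` units of the output good, where `t̄ = t - 5/k`. -/
theorem stmt_11 {G B : Type} [Fintype G] [Fintype B] [DecidableEq B]
    (M : FisherMarket G B) (ε : ℝ) (hε0 : 0 ≤ ε)
    (p : G → ℝ) (x : B → G → ℝ) (heq : M.IsApproxEquilibrium ε p x)
    (s a t k H Hlow Hhigh : ℝ)
    (hs : 0 < s) (hsa : s < a) (ha : 1 ≤ a)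
    (ht0 : 0 < t) (ht2 : t ≤ 1 / 2)
    (hk : 110 < k) (hsk : s ≤ 1 / (20 * k))
    (hHlow0 : 0 < Hlow) (hHlowH : Hlow ≤ H) (hHhigh : H ≤ Hhigh)
    (hratio : 1 - 4 / k ≤ Hlow / Hhigh)
    (ref : G) (href : p ref = H / s)
    (r : ℝ) (hr0 : 0 ≤ r) (hr1 : r ≤ 1) (hpos : 0 < 1 - 2 * t - r - ε)
    (gin gout : G) (i : B) (hinv : IsNotInverter M s a t Hlow ref gin gout i)
    (hpin0 : 0 < p gin) (hpout : 0 < p gout)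
    (hsum : 2 * (t - 5 / k) + r ≤ ∑ i' ∈ Finset.univ.erase i, x i' gout) :
    min H ((Hlow - p gin) * t / (1 - 2 * (t - 5 / k) - r + ε)) ≤ p gout := by
  obtain ⟨hp, hopt, hclear⟩ := heq
  have hspend := hinv.budget_le hs ht0 hp hpout (hopt i)
  obtain ⟨⟨hx0, hxb⟩, -⟩ := hopt i
  obtain ⟨hio, hir, hor, hb, -⟩ := hinv
  rw [min_le_iff, or_iff_not_imp_left, not_le]
  intro hlt
  have hcost := (three_le_sum (f := fun j => p j * x i j) hio hir hor
    fun j => mul_nonneg (hp j) (hx0 j)).trans hxb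
  simp only [hb, href] at hcost
  have hmin : p gin * min (x i gin) t ≤ p gin * x i gin :=
    mul_le_mul_of_nonneg_left (min_le_left _ _) hpin0.le
  have hmint : p gin * min (x i gin) t ≤ p gin * t :=
    mul_le_mul_of_nonneg_left (min_le_right _ _) hpin0.le
  have hprice : p gout / s < H / s := div_lt_div_of_pos_right hlt hs
  have href0 : x i ref = 0 := by
    refine le_antisymm (le_of_not_gt fun hpos_ref => ?_) (hx0 ref)
    linarith [mul_lt_mul_of_pos_right hprice hpos_ref]
  rw [href0, mul_zero] at hspend
  have htotal := (abs_le.1 (hclear gout)).2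
  rw [← Finset.add_sum_erase _ _ (Finset.mem_univ i)] at htotal
  have hk0 : 0 < 5 / k := div_pos (by norm_num) (by linarith)
  have hdem : x i gout ≤ 1 - 2 * (t - 5 / k) - r + ε := by linarith
  rw [div_le_iff₀ (by linarith)]
  linarith [mul_le_mul_of_nonneg_left hdem hpout.le]
end
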